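/- Second-moment bound for boundary-effect differences of persistent Betti numbers of a unit-intensity Poisson process: for fixed 0 ≤ r ≤ s, q, and i, sup_{n ∈ N} E[ |β_q^{r,s}(K(P' ∩ B_{⌊n m^{-d} a_i⌋})) − β_q^{r,s}(K(P' ∩ B_{n,i}))|^2 ] < ∞, where P' is a homogeneous Poisson process of unit intensity on R^d, B_k = [−k^{1/d}/2, k^{1/d}/2]^d, and B_{n,i} = [−(n m^{-d} a_i)^{1/d}/2, (n m^{-d} a_i)^{1/d}/2]^d. -/

import Mathlib

set_option autoImplicit false

open Submodule

/-- An abstract simplicial complex on vertex type `V`: a collection of finite nonempty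
subsets closed under taking nonempty subsets. -/
def IsComplex {V : Type*} (K : Set (Finset V)) : Prop :=
  ∀ σ ∈ K, σ.Nonempty ∧ ∀ τ : Finset V, τ ⊆ σ → τ.Nonempty → τ ∈ K

/-- The space of all `F₂`-chains on the vertex type `V`: the free `F₂`-vector space on
all finite subsets of `V`. -/
abbrev Chain (V : Type*) := Finset V →₀ ZMod 2

/-- The boundary map with `F₂`-coefficients, sending a simplex to the sum of its
codimension-one faces. -/
noncomputable def bdry (V : Type*) : Chain V →ₗ[ZMod 2] Chain V := by
  classical
  exact Finsupp.lsum (ZMod 2) fun σ =>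
    LinearMap.toSpanSingleton (ZMod 2) (Chain V) (∑ x ∈ σ, Finsupp.single (σ.erase x) 1)

/-- `C_q(K)`: the chain group of a complex `K`, the `F₂`-span of its `q`-simplices,
viewed as a subspace of the free `F₂`-vector space on all finite vertex sets. -/
noncomputable def chainGroup {V : Type*} (K : Set (Finset V)) (q : ℕ) :
    Submodule (ZMod 2) (Chain V) :=
  Submodule.span (ZMod 2)
    {c | ∃ σ ∈ K, σ.card = q + 1 ∧ c = Finsupp.single σ (1 : ZMod 2)}

/-- `Z_q(K)`: the cycle group of a complex `K`. -/
noncomputable def cycleGroup {V : Type*} (K : Set (Finset V)) (q : ℕ) :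
    Submodule (ZMod 2) (Chain V) :=
  chainGroup K q ⊓ LinearMap.ker (bdry V)

/-- `B_q(K)`: the boundary group of a complex `K`. -/
noncomputable def boundaryGroup {V : Type*} (K : Set (Finset V)) (q : ℕ) :
    Submodule (ZMod 2) (Chain V) :=
  Submodule.map (bdry V) (chainGroup K (q + 1))

/-- The `(r,s)`-persistent Betti number of a filtration
`Kf`: `dim (Z_q(K_r) / (Z_q(K_r) ∩ B_q(K_s)))`. -/
noncomputable def pBetti {V : Type*} (Kf : ℝ → Set (Finset V)) (q : ℕ) (r s : ℝ) : ℕ :=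
  Module.finrank (ZMod 2)
    (↥(cycleGroup (Kf r) q) ⧸
      (Submodule.comap (cycleGroup (Kf r) q).subtype (boundaryGroup (Kf s) q) :
        Submodule (ZMod 2) ↥(cycleGroup (Kf r) q)))

/-- Points of `ℝ^d`. -/
abbrev Pt (d : ℕ) := EuclideanSpace ℝ (Fin d)

/-- The Čech complex at scale `r` of a set `S ⊆ ℝ^d`: all finite nonempty `σ ⊆ S` whose
closed `r`-balls have a common point. -/
def cechCx (d : ℕ) (r : ℝ) (S : Set (Pt d)) : Set (Finset (Pt d)) :=
  {σ | ↑σ ⊆ S ∧ σ.Nonempty ∧ (⋂ x ∈ (σ : Set (Pt d)), Metric.closedBall x r).Nonempty}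

/-- The Vietoris–Rips complex at scale `r` of a set `S ⊆ ℝ^d`: all finite nonempty
`σ ⊆ S` of diameter at most `r`. -/
def ripsCx (d : ℕ) (r : ℝ) (S : Set (Pt d)) : Set (Finset (Pt d)) :=
  {σ | ↑σ ⊆ S ∧ σ.Nonempty ∧ Metric.diam (σ : Set (Pt d)) ≤ r}

/-- The `(r,s)`-persistent Betti number of the filtration `Kx` (Čech or Rips) built on the
point set `S ⊆ ℝ^d`. -/
noncomputable def pBettiPts {d : ℕ} (Kx : ℝ → Set (Pt d) → Set (Finset (Pt d)))
    (q : ℕ) (r s : ℝ) (S : Set (Pt d)) : ℕ :=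
  pBetti (fun t => Kx t S) q r s

open MeasureTheory in
/-- A point process `P` on `ℝ^d` is a Poisson point process with intensity function `f`
(w.r.t. the probability measure `μ`) if it is almost surely locally finite, the number of
its points in a region `A` is Poisson distributed with mean `∫ x in A, f x`, and the
point counts in disjoint regions are independent. -/
structure IsPoissonPP {Ω : Type*} [MeasurableSpace Ω] (μ : Measure Ω) {d : ℕ}
    (f : Pt d → ℝ) (P : Ω → Set (Pt d)) : Prop where
  locallyFinite : ∀ᵐ ω ∂μ, ∀ C : Set (Pt d), IsCompact C → (P ω ∩ C).Finite
  counts : ∀ A : Set (Pt d), MeasurableSet A → IntegrableOn f A volume →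
    ∀ n : ℕ, μ {ω | (P ω ∩ A).ncard = n ∧ (P ω ∩ A).Finite} =
      ENNReal.ofReal (Real.exp (-(∫ x in A, f x)) * (∫ x in A, f x) ^ n / n.factorial)
  indep : ∀ A B : Set (Pt d), MeasurableSet A → MeasurableSet B → Disjoint A B →
    ∀ sA sB : Set ℕ,
      μ ({ω | (P ω ∩ A).ncard ∈ sA} ∩ {ω | (P ω ∩ B).ncard ∈ sB}) =
        μ {ω | (P ω ∩ A).ncard ∈ sA} * μ {ω | (P ω ∩ B).ncard ∈ sB}

open MeasureTheory in
/-- Two point processes `P`, `P'` are independent if all their point counts are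
independent. -/
def IndepPP {Ω : Type*} [MeasurableSpace Ω] (μ : Measure Ω) {d : ℕ}
    (P P' : Ω → Set (Pt d)) : Prop :=
  ∀ A B : Set (Pt d), MeasurableSet A → MeasurableSet B → ∀ sA sB : Set ℕ,
    μ ({ω | (P ω ∩ A).ncard ∈ sA} ∩ {ω | (P' ω ∩ B).ncard ∈ sB}) =
      μ {ω | (P ω ∩ A).ncard ∈ sA} * μ {ω | (P' ω ∩ B).ncard ∈ sB}

/-- The centered cube `[-c/2, c/2]^d`. -/
def cubeC (d : ℕ) (c : ℝ) : Set (Pt d) := {x | ∀ i, |x i| ≤ c / 2}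

/-- The half-open unit cube `(-1/2, 1/2]^d + z` centered at `z`. -/
def cubeQ {d : ℕ} (z : Pt d) : Set (Pt d) :=
  {x | ∀ i, z i - 1 / 2 < x i ∧ x i ≤ z i + 1 / 2}

/-- The cube `[0, c]^d`. -/
def cube0 (d : ℕ) (c : ℝ) : Set (Pt d) := {x | ∀ i, 0 ≤ x i ∧ x i ≤ c}


section LinAlg

lemma pB_aux {W : Type*} [AddCommGroup W] [Module (ZMod 2) W] (Z B : Submodule (ZMod 2) W)
    [FiniteDimensional (ZMod 2) Z] :
    Module.finrank (ZMod 2) (Z ⧸ (Submodule.comap Z.subtype B)) +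
      Module.finrank (ZMod 2) (Z ⊓ B : Submodule (ZMod 2) W) = Module.finrank (ZMod 2) Z := by
  rw [← Submodule.finrank_quotient_add_finrank (Submodule.comap Z.subtype B),
    ← Submodule.map_comap_subtype, Submodule.finrank_map_subtype_eq]

lemma pB_inf {W : Type*} [AddCommGroup W] [Module (ZMod 2) W] {Z Z' B B' : Submodule (ZMod 2) W}
    [FiniteDimensional (ZMod 2) Z'] [FiniteDimensional (ZMod 2) B'] (hZ : Z ≤ Z') (hB : B ≤ B') :
    Module.finrank (ZMod 2) (Z' ⊓ B' : Submodule (ZMod 2) W) + Module.finrank (ZMod 2) Z +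
      Module.finrank (ZMod 2) B ≤ Module.finrank (ZMod 2) (Z ⊓ B : Submodule (ZMod 2) W) +
      Module.finrank (ZMod 2) Z' + Module.finrank (ZMod 2) B' := by
  have : FiniteDimensional (ZMod 2) Z := Submodule.finiteDimensional_of_le hZ
  have : FiniteDimensional (ZMod 2) B := Submodule.finiteDimensional_of_le hB
  have h1 := Submodule.finrank_sup_add_finrank_inf_eq Z B
  have h2 := Submodule.finrank_sup_add_finrank_inf_eq Z' B'
  have h3 : Module.finrank (ZMod 2) (Z ⊔ B : Submodule (ZMod 2) W) ≤
    Module.finrank (ZMod 2) (Z' ⊔ B' : Submodule (ZMod 2) W) :=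
    Submodule.finrank_mono (sup_le_sup hZ hB)
  omega

lemma chainGroup_mono {V : Type*} {K K' : Set (Finset V)} (h : K ⊆ K') (q : ℕ) :
    chainGroup K q ≤ chainGroup K' q := by
  apply Submodule.span_mono
  rintro c ⟨σ, hσ, h1, h2⟩
  exact ⟨σ, h hσ, h1, h2⟩

lemma chainGroup_fd {V : Type*} {K : Set (Finset V)} (h : K.Finite) (q : ℕ) :
    FiniteDimensional (ZMod 2) (chainGroup K q) := by
  apply FiniteDimensional.span_of_finite
  apply (h.image (fun σ => Finsupp.single σ (1 : ZMod 2))).subset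
  rintro c ⟨σ, hσ, -, rfl⟩
  exact ⟨σ, hσ, rfl⟩

lemma chainGroup_split {V : Type*} {K K' : Set (Finset V)} (q : ℕ)
    (F : Finset (Finset V)) (hF : ∀ σ ∈ K', σ ∉ K → σ.card = q + 1 → σ ∈ F) :
    ∃ G : Submodule (ZMod 2) (Chain V), FiniteDimensional (ZMod 2) G ∧
      Module.finrank (ZMod 2) G ≤ F.card ∧ chainGroup K' q ≤ chainGroup K q ⊔ G := by
  classical
  let T : Finset (Chain V) := F.image (fun σ => Finsupp.single σ (1 : ZMod 2))
  refine ⟨Submodule.span (ZMod 2) (T : Set (Chain V)), ?_, ?_, ?_⟩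
  · exact FiniteDimensional.span_finset _ _
  · exact (finrank_span_finset_le_card T).trans Finset.card_image_le
  · apply Submodule.span_le.2
    rintro c ⟨σ, hσ, h1, rfl⟩
    by_cases hK : σ ∈ K
    · exact Submodule.mem_sup_left (Submodule.subset_span ⟨σ, hK, h1, rfl⟩)
    · exact Submodule.mem_sup_right (Submodule.subset_span
        (Finset.mem_coe.2 (Finset.mem_image_of_mem _ (hF σ hσ hK h1))))

lemma pBetti_diff {V : Type*} {Kf Kf' : ℝ → Set (Finset V)} (q : ℕ) (r s : ℝ)
    (hsub : ∀ t, Kf t ⊆ Kf' t) (hfin : ∀ t, (Kf' t).Finite)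
    (F G : Finset (Finset V))
    (hF : ∀ σ ∈ Kf' r, σ ∉ Kf r → σ.card = q + 1 → σ ∈ F)
    (hG : ∀ σ ∈ Kf' s, σ ∉ Kf s → σ.card = q + 1 + 1 → σ ∈ G) :
    |(pBetti Kf q r s : ℝ) - (pBetti Kf' q r s : ℝ)| ≤ F.card + G.card := by
  obtain ⟨W1, fd1, c1, l1⟩ := chainGroup_split q F hF
  obtain ⟨W2, fd2, c2, l2⟩ := chainGroup_split (q + 1) G hG
  have := chainGroup_fd (hfin r) q
  have := chainGroup_fd (hfin s) (q + 1)
  have hC := chainGroup_mono (hsub r) q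
  have hC2 := chainGroup_mono (hsub s) (q + 1)
  have : FiniteDimensional (ZMod 2) (chainGroup (Kf r) q) := Submodule.finiteDimensional_of_le hC
  have : FiniteDimensional (ZMod 2) (chainGroup (Kf s) (q + 1)) :=
    Submodule.finiteDimensional_of_le hC2
  have : FiniteDimensional (ZMod 2) (cycleGroup (Kf' r) q) :=
    Submodule.finiteDimensional_of_le (inf_le_left)
  have : FiniteDimensional (ZMod 2) (cycleGroup (Kf r) q) :=
    Submodule.finiteDimensional_of_le (inf_le_left)
  have hZ : cycleGroup (Kf r) q ≤ cycleGroup (Kf' r) q := inf_le_inf_right _ hC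
  have hB : boundaryGroup (Kf s) q ≤ boundaryGroup (Kf' s) q := Submodule.map_mono hC2
  have : FiniteDimensional (ZMod 2) (boundaryGroup (Kf' s) q) := by
    unfold boundaryGroup; infer_instance
  have : FiniteDimensional (ZMod 2) (boundaryGroup (Kf s) q) := by
    unfold boundaryGroup; infer_instance
  have e1 := pB_aux (cycleGroup (Kf r) q) (boundaryGroup (Kf s) q)
  have e2 := pB_aux (cycleGroup (Kf' r) q) (boundaryGroup (Kf' s) q)
  have e3 := pB_inf hZ hB
  have e3' : Module.finrank (ZMod 2)
      (cycleGroup (Kf r) q ⊓ boundaryGroup (Kf s) q : Submodule (ZMod 2) (Chain V)) ≤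
      Module.finrank (ZMod 2)
      (cycleGroup (Kf' r) q ⊓ boundaryGroup (Kf' s) q : Submodule (ZMod 2) (Chain V)) :=
    Submodule.finrank_mono (inf_le_inf hZ hB)
  have e4 : Module.finrank (ZMod 2) (cycleGroup (Kf' r) q) ≤
      Module.finrank (ZMod 2) (cycleGroup (Kf r) q) + F.card := by
    have h1 := Submodule.finrank_sup_add_finrank_inf_eq (cycleGroup (Kf' r) q) (chainGroup (Kf r) q)
    have h2 : cycleGroup (Kf' r) q ⊓ chainGroup (Kf r) q = cycleGroup (Kf r) q := by
      unfold cycleGroup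
      rw [inf_right_comm, inf_eq_right.2 hC]
    rw [h2] at h1
    have h3 : Module.finrank (ZMod 2)
        (cycleGroup (Kf' r) q ⊔ chainGroup (Kf r) q : Submodule (ZMod 2) (Chain V)) ≤
        Module.finrank (ZMod 2) (chainGroup (Kf r) q ⊔ W1 : Submodule (ZMod 2) (Chain V)) :=
      Submodule.finrank_mono (sup_le (inf_le_left.trans l1) le_sup_left)
    have h4 := Submodule.finrank_add_le_finrank_add_finrank (chainGroup (Kf r) q) W1
    omega
  have e5 : Module.finrank (ZMod 2) (boundaryGroup (Kf' s) q) ≤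
      Module.finrank (ZMod 2) (boundaryGroup (Kf s) q) + G.card := by
    have h1 : boundaryGroup (Kf' s) q ≤ boundaryGroup (Kf s) q ⊔ W2.map (bdry V) := by
      unfold boundaryGroup
      rw [← Submodule.map_sup]
      exact Submodule.map_mono l2
    have h2 := Submodule.finrank_mono h1
    have h3 := Submodule.finrank_add_le_finrank_add_finrank (boundaryGroup (Kf s) q)
      (W2.map (bdry V))
    have h4 := Submodule.finrank_map_le (bdry V) W2
    omega
  have f1 : pBetti Kf q r s ≤ pBetti Kf' q r s + F.card + G.card := by
    unfold pBetti; omega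
  have f2 : pBetti Kf' q r s ≤ pBetti Kf q r s + F.card + G.card := by
    unfold pBetti; omega
  rw [abs_le]
  have f1' : (pBetti Kf q r s : ℝ) ≤ pBetti Kf' q r s + F.card + G.card := by exact_mod_cast f1
  have f2' : (pBetti Kf' q r s : ℝ) ≤ pBetti Kf q r s + F.card + G.card := by exact_mod_cast f2
  constructor <;> linarith

end LinAlg

section Geom

lemma Kx_facts {d : ℕ} {Kx : ℝ → Set (Pt d) → Set (Finset (Pt d))}
    (hKx : Kx = cechCx d ∨ Kx = ripsCx d) (t : ℝ) (S S' : Set (Pt d)) :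
    (S ⊆ S' → Kx t S ⊆ Kx t S') ∧ (∀ σ ∈ Kx t S', ↑σ ⊆ S → σ ∈ Kx t S) ∧
    (∀ σ ∈ Kx t S, ↑σ ⊆ S ∧ ∀ x ∈ σ, ∀ y ∈ σ, dist x y ≤ 2 * t) := by
  rcases hKx with rfl | rfl
  · refine ⟨fun h σ hσ => ⟨hσ.1.trans h, hσ.2⟩, fun σ hσ h => ⟨h, hσ.2⟩, fun σ hσ => ⟨hσ.1, ?_⟩⟩
    intro x hx y hy
    obtain ⟨c, hc⟩ := hσ.2.2
    simp only [Set.mem_iInter, Metric.mem_closedBall] at hc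
    have h1 := hc x hx
    have h2 := hc y hy
    have := dist_triangle_left x y c
    linarith
  · refine ⟨fun h σ hσ => ⟨hσ.1.trans h, hσ.2⟩, fun σ hσ h => ⟨h, hσ.2⟩, fun σ hσ => ⟨hσ.1, ?_⟩⟩
    intro x hx y hy
    have h1 : dist x y ≤ Metric.diam (σ : Set (Pt d)) :=
      Metric.dist_le_diam_of_mem σ.finite_toSet.isBounded hx hy
    have h2 := hσ.2.2
    have h3 : 0 ≤ dist x y := dist_nonneg
    linarith

/-- lattice cell index -/
noncomputable def cellIdx {d : ℕ} (x : Pt d) : Fin d → ℤ := fun i => ⌊x i⌋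

/-- lattice cell -/
def cellSet {d : ℕ} (z : Fin d → ℤ) : Set (Pt d) := {x | cellIdx x = z}

/-- neighbourhood of a lattice cell -/
noncomputable def nbhd {d : ℕ} (s : ℝ) (z : Fin d → ℤ) : Set (Pt d) :=
  Metric.closedBall (WithLp.toLp 2 (fun i => (z i : ℝ))) (2 * s + Real.sqrt d)

lemma mem_nbhd {d : ℕ} {s : ℝ} {x y : Pt d} (h : dist x y ≤ 2 * s) : y ∈ nbhd s (cellIdx x) := by
  unfold nbhd
  rw [Metric.mem_closedBall]
  have h1 : dist x (WithLp.toLp 2 (fun i => ((cellIdx x i : ℤ) : ℝ)) : Pt d) ≤ Real.sqrt d := by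
    rw [EuclideanSpace.dist_eq]
    apply Real.sqrt_le_sqrt
    calc _ ≤ ∑ i : Fin d, (1 : ℝ) := by
          apply Finset.sum_le_sum
          intro i _
          simp only [cellIdx, Real.dist_eq, sq_abs]
          have a := Int.floor_le (x i)
          have b := Int.lt_floor_add_one (x i)
          nlinarith
      _ = d := by simp
  have := dist_triangle y x (WithLp.toLp 2 (fun i => ((cellIdx x i : ℤ) : ℝ)) : Pt d)
  rw [dist_comm y x] at this
  linarith

lemma pBettiPts_diff {d : ℕ} {Kx : ℝ → Set (Pt d) → Set (Finset (Pt d))}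
    (hKx : Kx = cechCx d ∨ Kx = ripsCx d) (q : ℕ) (r s : ℝ) (hr : 0 ≤ r) (hrs : r ≤ s)
    (P : Set (Pt d)) (hP : ∀ C : Set (Pt d), Bornology.IsBounded C → (P ∩ C).Finite)
    (B B' : Set (Pt d)) (hB' : Bornology.IsBounded B') (hBB : B ⊆ B')
    (T : Finset (Pt d)) (hT : (T : Set (Pt d)) = P ∩ (B' \ B)) :
    |(pBettiPts Kx q r s (P ∩ B) : ℝ) - (pBettiPts Kx q r s (P ∩ B') : ℝ)| ≤
      ∑ x ∈ T, 2 * ((P ∩ nbhd s (cellIdx x)).ncard : ℝ) ^ (q + 2) := by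
  classical
  have hs : 0 ≤ s := hr.trans hrs
  let Y : Pt d → Finset (Pt d) := fun x =>
    (hP (nbhd s (cellIdx x)) Metric.isBounded_closedBall).toFinset
  have hY : ∀ x, (Y x).card = (P ∩ nbhd s (cellIdx x)).ncard := fun x =>
    (Set.ncard_eq_toFinset_card _ _).symm
  let F : ℕ → Finset (Finset (Pt d)) := fun j => T.biUnion fun x => (Y x).powersetCard j
  have hmain : ∀ t ≤ s, ∀ j, ∀ σ ∈ Kx t (P ∩ B'), σ ∉ Kx t (P ∩ B) → σ.card = j → σ ∈ F j := by
    intro t ht j σ h1 h2 h3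
    have hns : ¬ (↑σ ⊆ P ∩ B) := fun h => h2 ((Kx_facts hKx t (P ∩ B) (P ∩ B')).2.1 σ h1 h)
    obtain ⟨hσ, hdist⟩ := (Kx_facts hKx t (P ∩ B') (P ∩ B')).2.2 σ h1
    obtain ⟨x, hx, hxB⟩ := Set.not_subset.1 hns
    have hxT : x ∈ T := by
      rw [← Finset.mem_coe, hT]
      exact ⟨(hσ hx).1, (hσ hx).2, fun h => hxB ⟨(hσ hx).1, h⟩⟩
    simp only [F, Finset.mem_biUnion, Finset.mem_powersetCard]
    refine ⟨x, hxT, ?_, h3⟩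
    intro y hy
    simp only [Y, Set.Finite.mem_toFinset]
    exact ⟨(hσ hy).1, mem_nbhd ((hdist x hx y hy).trans (by linarith))⟩
  have hcard : ∀ j, j ≤ q + 2 → ((F j).card : ℝ) ≤
      ∑ x ∈ T, ((P ∩ nbhd s (cellIdx x)).ncard : ℝ) ^ (q + 2) := by
    intro j hj
    have : (F j).card ≤ ∑ x ∈ T, (P ∩ nbhd s (cellIdx x)).ncard ^ (q + 2) := by
      refine Finset.card_biUnion_le.trans (Finset.sum_le_sum fun x hx => ?_)
      rw [Finset.card_powersetCard, ← hY]
      refine (Nat.choose_le_pow _ _).trans (Nat.pow_le_pow_right ?_ hj)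
      apply Finset.card_pos.2
      refine ⟨x, ?_⟩
      simp only [Y, Set.Finite.mem_toFinset]
      rw [← Finset.mem_coe, hT] at hx
      exact ⟨hx.1, mem_nbhd (by simpa using hs)⟩
    exact_mod_cast this
  have h := pBetti_diff (Kf := fun t => Kx t (P ∩ B)) (Kf' := fun t => Kx t (P ∩ B')) q r s
    (fun t => (Kx_facts hKx t _ _).1 (Set.inter_subset_inter_right _ hBB))
    (fun t => by
      apply ((hP B' hB').toFinset.powerset.finite_toSet).subset
      intro σ hσ
      have := ((Kx_facts hKx t (P ∩ B') (P ∩ B')).2.2 σ hσ).1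
      simp only [Finset.coe_powerset, Set.mem_preimage, Set.mem_powerset_iff,
        Set.Finite.coe_toFinset]
      exact this) (F (q + 1)) (F (q + 1 + 1))
    (hmain r hrs _) (hmain s le_rfl _)
  refine h.trans ?_
  rw [← Finset.mul_sum]
  linarith [hcard (q + 1) (by omega), hcard (q + 1 + 1) (by omega)]

lemma sq_bound {d : ℕ} {Kx : ℝ → Set (Pt d) → Set (Finset (Pt d))}
    (hKx : Kx = cechCx d ∨ Kx = ripsCx d) (q : ℕ) (r s : ℝ) (hr : 0 ≤ r) (hrs : r ≤ s)
    (P : Set (Pt d)) (hP : ∀ C : Set (Pt d), Bornology.IsBounded C → (P ∩ C).Finite)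
    (B B' : Set (Pt d)) (hB' : Bornology.IsBounded B') (hBB : B ⊆ B') :
    ENNReal.ofReal (((pBettiPts Kx q r s (P ∩ B) : ℝ) - (pBettiPts Kx q r s (P ∩ B') : ℝ)) ^ 2) ≤
      ∑' z : Fin d → ℤ, 2 * (((P ∩ ((B' \ B) ∩ cellSet z)).ncard : ENNReal) *
          ((P ∩ (B' \ B)).ncard : ENNReal) ^ (1 + 1) +
        ((P ∩ ((B' \ B) ∩ cellSet z)).ncard : ENNReal) *
          ((P ∩ nbhd s z).ncard : ENNReal) ^ ((4 * q + 7) + 1)) := by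
  classical
  have hfin : (P ∩ (B' \ B)).Finite := hP _ (hB'.subset Set.sdiff_subset)
  let T := hfin.toFinset
  have hT : (T : Set (Pt d)) = P ∩ (B' \ B) := hfin.coe_toFinset
  have hTc : T.card = (P ∩ (B' \ B)).ncard := (Set.ncard_eq_toFinset_card _ _).symm
  have h1 := pBettiPts_diff hKx q r s hr hrs P hP B B' hB' hBB T hT
  let y : (Fin d → ℤ) → ℕ := fun z => (P ∩ nbhd s z).ncard
  have h2 : ((pBettiPts Kx q r s (P ∩ B) : ℝ) - (pBettiPts Kx q r s (P ∩ B') : ℝ)) ^ 2 ≤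
      ∑ x ∈ T, 2 * ((T.card : ℝ) ^ 2 + (y (cellIdx x) : ℝ) ^ (4 * q + 8)) := by
    calc _ = |(pBettiPts Kx q r s (P ∩ B) : ℝ) - (pBettiPts Kx q r s (P ∩ B') : ℝ)| ^ 2 :=
          (sq_abs _).symm
      _ ≤ (∑ x ∈ T, 2 * (y (cellIdx x) : ℝ) ^ (q + 2)) ^ 2 := by
          gcongr
      _ ≤ T.card * ∑ x ∈ T, (2 * (y (cellIdx x) : ℝ) ^ (q + 2)) ^ 2 := sq_sum_le_card_mul_sum_sq
      _ ≤ _ := by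
          rw [Finset.mul_sum]
          apply Finset.sum_le_sum
          intro x _
          have : (y (cellIdx x) : ℝ) ^ (4 * q + 8) = (((y (cellIdx x) : ℝ) ^ (q + 2)) ^ 2) ^ 2 := by
            rw [← pow_mul, ← pow_mul]; congr 1; ring
          rw [this]
          nlinarith [sq_nonneg ((T.card : ℝ) - ((y (cellIdx x) : ℝ) ^ (q + 2)) ^ 2)]
  let g : (Fin d → ℤ) → ℕ := fun z => 2 * (T.card ^ 2 + y z ^ (4 * q + 8))
  have h3 : ((pBettiPts Kx q r s (P ∩ B) : ℝ) - (pBettiPts Kx q r s (P ∩ B') : ℝ)) ^ 2 ≤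
      ((∑ x ∈ T, g (cellIdx x) : ℕ) : ℝ) := by
    refine h2.trans (le_of_eq ?_)
    push_cast [g]
    rfl
  refine (ENNReal.ofReal_le_ofReal h3).trans ?_
  rw [ENNReal.ofReal_natCast, Finset.sum_comp g cellIdx]
  push_cast
  refine le_trans (Finset.sum_le_sum ?_) (ENNReal.sum_le_tsum (T.image cellIdx))
  intro z _
  have h4 : (T.filter fun a => cellIdx a = z).card = (P ∩ ((B' \ B) ∩ cellSet z)).ncard := by
    rw [← Set.ncard_coe_finset]
    congr 1
    ext x
    rw [← Set.inter_assoc, ← hT]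
    simp [cellSet]
  rw [h4, nsmul_eq_mul]
  simp only [g, y, hTc]
  push_cast
  apply le_of_eq
  ring

end Geom

section Prob

open MeasureTheory ProbabilityTheory

variable {Ω : Type*} [MeasurableSpace Ω] {μ : Measure Ω} [IsProbabilityMeasure μ] {d : ℕ}
  {P : Ω → Set (Pt d)}

lemma pp_ae_finite (hP : IsPoissonPP μ (fun _ : Pt d => (1 : ℝ)) P) :
    ∀ᵐ ω ∂μ, ∀ C : Set (Pt d), Bornology.IsBounded C → (P ω ∩ C).Finite := by
  filter_upwards [hP.locallyFinite] with ω hω C hC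
  exact (hω (closure C) hC.isCompact_closure).subset
    (Set.inter_subset_inter_right _ subset_closure)

lemma pp_count (hP : IsPoissonPP μ (fun _ : Pt d => (1 : ℝ)) P) {A : Set (Pt d)}
    (hA : MeasurableSet A) (hb : Bornology.IsBounded A) (n : ℕ) :
    μ {ω | (P ω ∩ A).ncard = n} =
      ENNReal.ofReal (Real.exp (-(volume A).toReal) * (volume A).toReal ^ n / n.factorial) := by
  have hfin : volume A ≠ ⊤ := hb.measure_lt_top.ne
  have h := hP.counts A hA (integrableOn_const hfin) n
  have h2 : ∫ x in A, (1 : ℝ) = (volume A).toReal := by simp [Measure.real]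
  rw [h2] at h
  rw [← h]
  apply measure_congr
  filter_upwards [pp_ae_finite hP] with ω hω
  apply propext
  exact ⟨fun h => ⟨h, hω A hb⟩, fun h => h.1⟩

lemma pp_tsum (hP : IsPoissonPP μ (fun _ : Pt d => (1 : ℝ)) P) {A : Set (Pt d)}
    (hA : MeasurableSet A) (hb : Bornology.IsBounded A) :
    ∑' n : ℕ, μ {ω | (P ω ∩ A).ncard = n} = 1 := by
  simp_rw [pp_count hP hA hb]
  have h := hasSum_one_poissonMeasure (volume A).toNNReal
  have h' : HasSum (fun n : ℕ => Real.exp (-(volume A).toReal) * (volume A).toReal ^ n /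
    (n.factorial : ℝ)) 1 := h
  rw [← ENNReal.ofReal_tsum_of_nonneg (fun n => by positivity) h'.summable, h'.tsum_eq,
    ENNReal.ofReal_one]

lemma nullMeas_of_add_le {E : Set Ω} (h : μ E + μ Eᶜ ≤ 1) : NullMeasurableSet E μ := by
  have hT := measurableSet_toMeasurable μ E
  have hS := measurableSet_toMeasurable μ Eᶜ
  have hu : toMeasurable μ E ∪ toMeasurable μ Eᶜ = Set.univ := by
    rw [Set.eq_univ_iff_forall]
    intro x
    by_cases hx : x ∈ E
    · exact Or.inl (subset_toMeasurable μ E hx)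
    · exact Or.inr (subset_toMeasurable μ Eᶜ hx)
  have h1 := measure_union_add_inter (μ := μ) (toMeasurable μ E) hS
  rw [hu, measure_univ, measure_toMeasurable, measure_toMeasurable] at h1
  have h0 : μ (toMeasurable μ E ∩ toMeasurable μ Eᶜ) = 0 := by
    rw [← h1] at h
    by_contra hne
    exact absurd h (not_le.2 (ENNReal.lt_add_right ENNReal.one_ne_top hne))
  have : E =ᵐ[μ] toMeasurable μ E := by
    refine Filter.EventuallyLE.antisymm (subset_toMeasurable μ E).eventuallyLE ?_
    rw [ae_le_set]
    refine measure_mono_null ?_ h0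
    intro x hx
    exact ⟨hx.1, subset_toMeasurable μ Eᶜ hx.2⟩
  exact hT.nullMeasurableSet.congr this.symm

lemma pp_aem (hP : IsPoissonPP μ (fun _ : Pt d => (1 : ℝ)) P) {A : Set (Pt d)}
    (hA : MeasurableSet A) (hb : Bornology.IsBounded A) :
    AEMeasurable (fun ω => (P ω ∩ A).ncard) μ := by
  have key : ∀ s : Set ℕ, μ ((fun ω => (P ω ∩ A).ncard) ⁻¹' s) ≤
      ∑' n : s, μ {ω | (P ω ∩ A).ncard = n} := by
    intro s
    refine le_trans (measure_mono ?_)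
      (measure_biUnion_le μ s.to_countable (fun n => {ω | (P ω ∩ A).ncard = n}))
    intro ω hω
    simp only [Set.mem_iUnion]
    exact ⟨_, hω, rfl⟩
  have hnm : NullMeasurable (fun ω => (P ω ∩ A).ncard) μ := by
    intro s _
    apply nullMeas_of_add_le
    rw [← Set.preimage_compl]
    refine (add_le_add (key s) (key sᶜ)).trans (le_of_eq ?_)
    rw [← pp_tsum hP hA hb]
    rw [tsum_subtype s (fun n : ℕ => μ {ω | (P ω ∩ A).ncard = n}),
      tsum_subtype sᶜ (fun n : ℕ => μ {ω | (P ω ∩ A).ncard = n}), ← ENNReal.tsum_add]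
    congr 1
    ext n
    exact congrFun (Set.indicator_self_add_compl s (fun n : ℕ => μ {ω | (P ω ∩ A).ncard = n})) n
  exact hnm.aemeasurable

lemma pp_lintegral (hP : IsPoissonPP μ (fun _ : Pt d => (1 : ℝ)) P) {A : Set (Pt d)}
    (hA : MeasurableSet A) (hb : Bornology.IsBounded A) (g : ℕ → ENNReal) :
    ∫⁻ ω, g (P ω ∩ A).ncard ∂μ = ∑' n : ℕ, g n *
      ENNReal.ofReal (Real.exp (-(volume A).toReal) * (volume A).toReal ^ n / n.factorial) := by
  have hm := pp_aem hP hA hb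
  rw [← lintegral_map' (f := g) (by fun_prop) hm, lintegral_countable']
  congr 1
  ext n
  rw [Measure.map_apply_of_aemeasurable hm (MeasurableSet.singleton n), ← pp_count hP hA hb]
  rfl

/-- moment constant -/
noncomputable def momC (L : ℝ) (p : ℕ) : ENNReal :=
  ∑' n : ℕ, ENNReal.ofReal ((n : ℝ) ^ (p + 1) * (L ^ n / n.factorial))

lemma momC_ne_top {L : ℝ} (hL : 0 ≤ L) (p : ℕ) : momC L p ≠ ⊤ := by
  unfold momC
  have hs : Summable (fun n : ℕ => (n : ℝ) ^ (p + 1) * (L ^ n / n.factorial)) := by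
    have h1 : Summable (fun n : ℕ => ((p + 1).factorial : ℝ) *
        ((Real.exp 1 * L) ^ n / n.factorial)) :=
      (Real.summable_pow_div_factorial (Real.exp 1 * L)).mul_left _
    refine Summable.of_nonneg_of_le (fun n => by positivity) (fun n => ?_) h1
    have h2 : (n : ℝ) ^ (p + 1) / (p + 1).factorial ≤ Real.exp n :=
      Real.pow_div_factorial_le_exp _ (by positivity) _
    rw [div_le_iff₀ (by positivity)] at h2
    have h3 : Real.exp n = Real.exp 1 ^ n := by rw [← Real.exp_nat_mul, mul_one]
    calc _ ≤ (Real.exp n * (p + 1).factorial) * (L ^ n / n.factorial) := by gcongr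
      _ = _ := by rw [h3, mul_pow]; ring
  exact hs.tsum_ofReal_ne_top

lemma pp_moment (hP : IsPoissonPP μ (fun _ : Pt d => (1 : ℝ)) P) {A : Set (Pt d)}
    (hA : MeasurableSet A) (hb : Bornology.IsBounded A) {L : ℝ} (hL : 1 ≤ L)
    (hAL : volume A ≤ ENNReal.ofReal L) (p : ℕ) :
    ∫⁻ ω, ((P ω ∩ A).ncard : ENNReal) ^ (p + 1) ∂μ ≤ momC L p * volume A := by
  have hfin : volume A ≠ ⊤ := hb.measure_lt_top.ne
  rw [pp_lintegral hP hA hb (fun n => (n : ENNReal) ^ (p + 1))]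
  unfold momC
  rw [← ENNReal.tsum_mul_right]
  apply ENNReal.tsum_le_tsum
  intro n
  have hl : (volume A).toReal ≤ L := ENNReal.toReal_le_of_le_ofReal (by linarith) hAL
  rw [← ENNReal.ofReal_toReal hfin]
  set l := (volume A).toReal with hldef
  have hl0 : 0 ≤ l := ENNReal.toReal_nonneg
  rw [ENNReal.toReal_ofReal hl0]
  have : (n : ENNReal) ^ (p + 1) = ENNReal.ofReal ((n : ℝ) ^ (p + 1)) := by
    rw [ENNReal.ofReal_pow (by positivity), ENNReal.ofReal_natCast]
  rw [this, ← ENNReal.ofReal_mul (by positivity), ← ENNReal.ofReal_mul (by positivity)]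
  apply ENNReal.ofReal_le_ofReal
  rcases n with _ | n
  · simp
  · have h1 : Real.exp (-l) ≤ 1 := by simpa using hl0
    have h2 : l ^ (n + 1) ≤ L ^ (n + 1) * l := by
      rw [pow_succ]
      gcongr
      calc l ^ n ≤ L ^ n := by gcongr
        _ ≤ L ^ (n + 1) := pow_le_pow_right₀ hL (by omega)
    have h3 : Real.exp (-l) * l ^ (n + 1) ≤ L ^ (n + 1) * l := by
      calc _ ≤ 1 * l ^ (n + 1) := by gcongr
        _ ≤ _ := by rw [one_mul]; exact h2
    calc _ ≤ ((n + 1 : ℕ) : ℝ) ^ (p + 1) * ((L ^ (n + 1) * l) / (n + 1).factorial) := by gcongr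
      _ = _ := by ring

lemma pp_indep (hP : IsPoissonPP μ (fun _ : Pt d => (1 : ℝ)) P) {A B : Set (Pt d)}
    (hA : MeasurableSet A) (hB : MeasurableSet B) (hAB : Disjoint A B) :
    IndepFun (fun ω => (P ω ∩ A).ncard) (fun ω => (P ω ∩ B).ncard) μ := by
  rw [indepFun_iff_measure_inter_preimage_eq_mul]
  intro s t _ _
  exact hP.indep A B hA hB hAB s t

/-- mixed moment constant -/
noncomputable def mixC (L : ℝ) (p : ℕ) : ENNReal :=
  2 ^ p * (momC L (p + 1) + momC L 0 * (momC L p * ENNReal.ofReal L))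

lemma mixC_ne_top {L : ℝ} (hL : 0 ≤ L) (p : ℕ) : mixC L p ≠ ⊤ := by
  unfold mixC
  have := momC_ne_top hL
  finiteness [this p, this 0, this (p + 1)]

lemma pp_mixed (hP : IsPoissonPP μ (fun _ : Pt d => (1 : ℝ)) P) {U V : Set (Pt d)}
    (hU : MeasurableSet U) (hV : MeasurableSet V) (hUV : U ⊆ V) (hb : Bornology.IsBounded V)
    {L : ℝ} (hL : 1 ≤ L) (hVL : volume V ≤ ENNReal.ofReal L) (p : ℕ) :
    ∫⁻ ω, ((P ω ∩ U).ncard : ENNReal) * ((P ω ∩ V).ncard : ENNReal) ^ (p + 1) ∂μ ≤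
      mixC L p * volume U := by
  have hW : MeasurableSet (V \ U) := hV.diff hU
  have hbU := hb.subset hUV
  have hbW : Bornology.IsBounded (V \ U) := hb.subset Set.sdiff_subset
  have hWL : volume (V \ U) ≤ ENNReal.ofReal L := (measure_mono Set.sdiff_subset).trans hVL
  have hUL : volume U ≤ ENNReal.ofReal L := (measure_mono hUV).trans hVL
  have mU := pp_aem hP hU hbU
  have mW := pp_aem hP hW hbW
  have mU' : ∀ k : ℕ, AEMeasurable (fun ω => ((P ω ∩ U).ncard : ENNReal) ^ k) μ := fun k =>
    (measurable_of_countable (fun n : ℕ => (n : ENNReal) ^ k)).comp_aemeasurable mU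
  have mW' : ∀ k : ℕ, AEMeasurable (fun ω => ((P ω ∩ (V \ U)).ncard : ENNReal) ^ k) μ := fun k =>
    (measurable_of_countable (fun n : ℕ => (n : ENNReal) ^ k)).comp_aemeasurable mW
  have hpt : ∀ ω, ((P ω ∩ U).ncard : ENNReal) * ((P ω ∩ V).ncard : ENNReal) ^ (p + 1) ≤
      2 ^ p * (((P ω ∩ U).ncard : ENNReal) ^ (p + 1 + 1) +
        ((P ω ∩ U).ncard : ENNReal) ^ (0 + 1) * ((P ω ∩ (V \ U)).ncard : ENNReal) ^ (p + 1)) := by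
    intro ω
    have h1 : (P ω ∩ V).ncard ≤ (P ω ∩ U).ncard + (P ω ∩ (V \ U)).ncard := by
      refine le_trans (le_of_eq ?_) (Set.ncard_union_le _ _)
      rw [← Set.inter_union_distrib_left, Set.union_sdiff_cancel hUV]
    have h2 : (P ω ∩ U).ncard * (P ω ∩ V).ncard ^ (p + 1) ≤
      2 ^ p * ((P ω ∩ U).ncard ^ (p + 1 + 1) +
        (P ω ∩ U).ncard ^ (0 + 1) * (P ω ∩ (V \ U)).ncard ^ (p + 1)) := by
      calc _ ≤ (P ω ∩ U).ncard * ((P ω ∩ U).ncard + (P ω ∩ (V \ U)).ncard) ^ (p + 1) := by gcongr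
        _ ≤ (P ω ∩ U).ncard *
            (2 ^ p * ((P ω ∩ U).ncard ^ (p + 1) + (P ω ∩ (V \ U)).ncard ^ (p + 1))) := by
            gcongr
            exact add_pow_le (Nat.zero_le _) (Nat.zero_le _) (p + 1)
        _ = _ := by ring
    exact_mod_cast h2
  refine (lintegral_mono hpt).trans ?_
  rw [lintegral_const_mul' _ _ (by finiteness), lintegral_add_left' (mU' _)]
  have hi : IndepFun (fun ω => ((P ω ∩ U).ncard : ENNReal) ^ (0 + 1))
      (fun ω => ((P ω ∩ (V \ U)).ncard : ENNReal) ^ (p + 1)) μ :=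
    (pp_indep hP hU hW Set.disjoint_sdiff_right).comp
      (measurable_of_countable (fun n : ℕ => (n : ENNReal) ^ (0 + 1)))
      (measurable_of_countable (fun n : ℕ => (n : ENNReal) ^ (p + 1)))
  have hmul := lintegral_mul_eq_lintegral_mul_lintegral_of_indepFun'' (mU' _) (mW' _) hi
  rw [hmul]
  have a1 := pp_moment hP hU hbU hL hUL (p + 1)
  have a2 := pp_moment hP hU hbU hL hUL 0
  have a3 := pp_moment hP hW hbW hL hWL p
  unfold mixC
  calc _ ≤ 2 ^ p * (momC L (p + 1) * volume U +
        (momC L 0 * volume U) * (momC L p * ENNReal.ofReal L)) := by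
        gcongr
        exact a3.trans (by gcongr)
    _ = _ := by ring

end Prob

section Cubes

open MeasureTheory

lemma cubeC_eq (d : ℕ) (c : ℝ) : cubeC d c =
    WithLp.ofLp ⁻¹' (Set.Icc (fun _ : Fin d => -(c / 2)) (fun _ : Fin d => c / 2)) := by
  ext x
  simp only [cubeC, Set.mem_ofPred_eq, Set.mem_preimage, Set.mem_Icc, Pi.le_def, abs_le]
  exact forall_and

lemma cubeC_meas (d : ℕ) (c : ℝ) : MeasurableSet (cubeC d c) := by
  rw [cubeC_eq]
  exact (PiLp.volume_preserving_ofLp (Fin d)).measurable measurableSet_Icc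

lemma cubeC_vol (d : ℕ) (c : ℝ) : volume (cubeC d c) = ENNReal.ofReal c ^ d := by
  rw [cubeC_eq, (PiLp.volume_preserving_ofLp (Fin d)).measure_preimage
    measurableSet_Icc.nullMeasurableSet, Real.volume_Icc_pi]
  simp

lemma cubeC_vol' {d : ℕ} (hd : 1 ≤ d) {t : ℝ} (ht : 0 ≤ t) :
    volume (cubeC d (t ^ ((1 : ℝ) / d))) = ENNReal.ofReal t := by
  rw [cubeC_vol, ← ENNReal.ofReal_pow (by positivity)]
  congr 1
  rw [one_div]
  exact Real.rpow_inv_natCast_pow ht (by omega)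

lemma cubeC_bdd (d : ℕ) (c : ℝ) : Bornology.IsBounded (cubeC d c) := by
  rw [Metric.isBounded_iff_subset_closedBall 0]
  refine ⟨Real.sqrt (∑ i : Fin d, (c / 2) ^ 2), fun x hx => ?_⟩
  rw [Metric.mem_closedBall, dist_zero_right, EuclideanSpace.norm_eq]
  apply Real.sqrt_le_sqrt
  apply Finset.sum_le_sum
  intro i _
  have := hx i
  rw [Real.norm_eq_abs]
  gcongr

lemma cellSet_meas {d : ℕ} (z : Fin d → ℤ) : MeasurableSet (cellSet (d := d) z) := by
  have : Measurable (cellIdx (d := d)) := by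
    unfold cellIdx
    apply measurable_pi_lambda
    intro i
    apply Int.measurable_floor.comp
    fun_prop
  exact this (MeasurableSet.singleton z)

end Cubes
open MeasureTheory in
/-- Second-moment bound for boundary-effect differences of persistent
Betti numbers of a unit-intensity Poisson process: for fixed `0 ≤ r ≤ s`, `q`, `m` and
`aᵢ > 0`,
`sup_n E[ |β_q^{r,s}(K(P' ∩ B_{⌊n m^{-d} aᵢ⌋})) − β_q^{r,s}(K(P' ∩ B_{n,i}))|² ] < ∞`,
where `P'` is a homogeneous Poisson process of unit intensity on `ℝ^d`,
`B_k = [−k^{1/d}/2, k^{1/d}/2]^d` and `B_{n,i} = [−(n m^{-d} aᵢ)^{1/d}/2,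
(n m^{-d} aᵢ)^{1/d}/2]^d`. -/
theorem second_moment_boundary_effect {Ω : Type*} [MeasurableSpace Ω]
    (μ : Measure Ω) [IsProbabilityMeasure μ] {d : ℕ} (hd : 1 ≤ d)
    (P' : Ω → Set (Pt d)) (hP' : IsPoissonPP μ (fun _ : Pt d => (1 : ℝ)) P')
    (Kx : ℝ → Set (Pt d) → Set (Finset (Pt d))) (hKx : Kx = cechCx d ∨ Kx = ripsCx d)
    (q : ℕ) (r s : ℝ) (hr : 0 ≤ r) (hrs : r ≤ s)
    (m : ℕ) (hm : 0 < m) (ai : ℝ) (hai : 0 < ai) :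
    ∃ C : ℝ, ∀ n : ℕ,
      ∫ ω, (((pBettiPts Kx q r s (P' ω ∩
            cubeC d ((⌊(n : ℝ) * (m : ℝ) ^ (-(d : ℤ)) * ai⌋₊ : ℝ) ^ ((1 : ℝ) / d))) : ℝ) -
          (pBettiPts Kx q r s (P' ω ∩
            cubeC d (((n : ℝ) * (m : ℝ) ^ (-(d : ℤ)) * ai) ^ ((1 : ℝ) / d))) : ℝ)) ^ 2) ∂μ
        ≤ C := by
  classical
  set R : ℝ := 2 * s + Real.sqrt d with hR
  have hVfin : volume (Metric.closedBall (0 : Pt d) R) ≠ ⊤ := measure_closedBall_lt_top.ne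
  set L : ℝ := max 1 (volume (Metric.closedBall (0 : Pt d) R)).toReal with hLdef
  have hL1 : 1 ≤ L := le_max_left _ _
  have hVL : ∀ z : Fin d → ℤ, volume (nbhd s z) ≤ ENNReal.ofReal L := by
    intro z
    unfold nbhd
    rw [Measure.addHaar_closedBall_center, ← ENNReal.ofReal_toReal hVfin]
    exact ENNReal.ofReal_le_ofReal (le_max_right _ _)
  set K : ENNReal := 2 * (mixC L 1 + mixC L (4 * q + 7)) with hK
  have hKtop : K ≠ ⊤ := by
    have h1 := mixC_ne_top (L := L) (by linarith) 1
    have h2 := mixC_ne_top (L := L) (by linarith) (4 * q + 7)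
    rw [hK]
    finiteness
  refine ⟨K.toReal, fun n => ?_⟩
  set t : ℝ := (n : ℝ) * (m : ℝ) ^ (-(d : ℤ)) * ai with ht
  have ht0 : 0 ≤ t := by positivity
  set B : Set (Pt d) := cubeC d ((⌊t⌋₊ : ℝ) ^ ((1 : ℝ) / d)) with hBdef
  set B' : Set (Pt d) := cubeC d (t ^ ((1 : ℝ) / d)) with hB'def
  have hBB : B ⊆ B' := by
    intro x hx i
    refine (hx i).trans ?_
    have := Nat.floor_le ht0
    gcongr
  have hA : MeasurableSet (B' \ B) := (cubeC_meas _ _).diff (cubeC_meas _ _)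
  have hAb : Bornology.IsBounded (B' \ B) := (cubeC_bdd _ _).subset Set.sdiff_subset
  have hvol : volume (B' \ B) ≤ 1 := by
    rw [measure_sdiff hBB (cubeC_meas _ _).nullMeasurableSet (cubeC_bdd _ _).measure_lt_top.ne,
      cubeC_vol' hd ht0, cubeC_vol' hd (by positivity), ← ENNReal.ofReal_sub _ (by positivity),
      ← ENNReal.ofReal_one]
    apply ENNReal.ofReal_le_ofReal
    have := Nat.lt_floor_add_one t
    linarith
  have hAL : volume (B' \ B) ≤ ENNReal.ofReal L :=
    hvol.trans (by rw [← ENNReal.ofReal_one]; exact ENNReal.ofReal_le_ofReal hL1)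
  have cellsub : ∀ z : Fin d → ℤ, cellSet z ⊆ nbhd (d := d) s z := by
    rintro z x rfl
    exact mem_nbhd (by simpa using hr.trans hrs)
  have hcm : ∀ z, MeasurableSet ((B' \ B) ∩ cellSet z) := fun z => hA.inter (cellSet_meas z)
  have hnm : ∀ z, MeasurableSet (nbhd (d := d) s z) := fun z => Metric.isClosed_closedBall.measurableSet
  have hnb : ∀ z, Bornology.IsBounded (nbhd (d := d) s z) := fun z => Metric.isBounded_closedBall
  have maem : ∀ {U : Set (Pt d)}, MeasurableSet U → Bornology.IsBounded U → ∀ k : ℕ,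
      AEMeasurable (fun ω => ((P' ω ∩ U).ncard : ENNReal) ^ k) μ := fun hU hb k =>
    (measurable_of_countable (fun n : ℕ => (n : ENNReal) ^ k)).comp_aemeasurable (pp_aem hP' hU hb)
  have maem1 : ∀ {U : Set (Pt d)}, MeasurableSet U → Bornology.IsBounded U →
      AEMeasurable (fun ω => ((P' ω ∩ U).ncard : ENNReal)) μ := fun hU hb =>
    (measurable_of_countable (fun n : ℕ => (n : ENNReal))).comp_aemeasurable (pp_aem hP' hU hb)
  have hcb : ∀ z, Bornology.IsBounded ((B' \ B) ∩ cellSet z) := fun z =>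
    hAb.subset Set.inter_subset_left
  have m1 : ∀ z, AEMeasurable (fun ω => ((P' ω ∩ ((B' \ B) ∩ cellSet z)).ncard : ENNReal) *
          ((P' ω ∩ (B' \ B)).ncard : ENNReal) ^ (1 + 1)) μ := fun z =>
    (maem1 (hcm z) (hcb z)).mul (maem hA hAb _)
  have m2 : ∀ z, AEMeasurable (fun ω => ((P' ω ∩ ((B' \ B) ∩ cellSet z)).ncard : ENNReal) *
          ((P' ω ∩ nbhd s z).ncard : ENNReal) ^ ((4 * q + 7) + 1)) μ := fun z =>
    (maem1 (hcm z) (hcb z)).mul (maem (hnm z) (hnb z) _)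
  have hsumvol : ∑' z : Fin d → ℤ, volume ((B' \ B) ∩ cellSet z) = volume (B' \ B) := by
    rw [← measure_iUnion _ hcm]
    · congr 1
      ext x
      simp [cellSet]
    · intro z w hzw
      rw [Function.onFun, Set.disjoint_left]
      rintro x ⟨-, hx⟩ ⟨-, hx'⟩
      exact hzw (hx.symm.trans hx')
  have hmain : ∫⁻ ω, ENNReal.ofReal (((pBettiPts Kx q r s (P' ω ∩ B) : ℝ) -
      (pBettiPts Kx q r s (P' ω ∩ B') : ℝ)) ^ 2) ∂μ ≤ K := by
    calc _ ≤ ∫⁻ ω, ∑' z : Fin d → ℤ, 2 * (((P' ω ∩ ((B' \ B) ∩ cellSet z)).ncard : ENNReal) *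
          ((P' ω ∩ (B' \ B)).ncard : ENNReal) ^ (1 + 1) +
        ((P' ω ∩ ((B' \ B) ∩ cellSet z)).ncard : ENNReal) *
          ((P' ω ∩ nbhd s z).ncard : ENNReal) ^ ((4 * q + 7) + 1)) ∂μ := by
          apply lintegral_mono_ae
          filter_upwards [pp_ae_finite hP'] with ω hω
          exact sq_bound hKx q r s hr hrs (P' ω) hω B B' (cubeC_bdd _ _) hBB
      _ = ∑' z : Fin d → ℤ, ∫⁻ ω, 2 * (((P' ω ∩ ((B' \ B) ∩ cellSet z)).ncard : ENNReal) *
          ((P' ω ∩ (B' \ B)).ncard : ENNReal) ^ (1 + 1) +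
        ((P' ω ∩ ((B' \ B) ∩ cellSet z)).ncard : ENNReal) *
          ((P' ω ∩ nbhd s z).ncard : ENNReal) ^ ((4 * q + 7) + 1)) ∂μ :=
          lintegral_tsum fun z => ((m1 z).add (m2 z)).const_mul 2
      _ ≤ ∑' z : Fin d → ℤ, K * volume ((B' \ B) ∩ cellSet z) := by
          apply ENNReal.tsum_le_tsum
          intro z
          rw [lintegral_const_mul' _ _ (by finiteness), lintegral_add_left' (m1 z)]
          have a1 := pp_mixed hP' (hcm z) hA Set.inter_subset_left hAb hL1 hAL 1
          have a2 := pp_mixed hP' (hcm z) (hnm z) (Set.inter_subset_right.trans (cellsub z))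
            (hnb z) hL1 (hVL z) (4 * q + 7)
          rw [hK, mul_assoc, add_mul]
          gcongr
      _ = K * volume (B' \ B) := by rw [ENNReal.tsum_mul_left, hsumvol]
      _ ≤ K := by
          calc K * volume (B' \ B) ≤ K * 1 := by gcongr
            _ = K := mul_one K
  by_cases hint : AEStronglyMeasurable (fun ω => ((pBettiPts Kx q r s (P' ω ∩ B) : ℝ) -
      (pBettiPts Kx q r s (P' ω ∩ B') : ℝ)) ^ 2) μ
  · rw [integral_eq_lintegral_of_nonneg_ae (Filter.Eventually.of_forall fun ω => sq_nonneg _) hint]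
    exact ENNReal.toReal_mono hKtop hmain
  · rw [integral_undef (fun h => hint h.1)]
    exact ENNReal.toReal_nonneg
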